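/- arXiv:1910.13378 — 2 statements merged into one kernel-verified Lean document; each statement's English description precedes it below -/
import Mathlib

section
/- For all positive integers a, b, c: ∑_{λ ⊆ (a^b)} g_λ(x_1,…,x_c) = s_{(a^b)}(1^b, x_1,…,x_c), where the sum is over all partitions λ (including the empty partition, with g_∅ = 1) whose Young diagram fits inside the b×a rectangle, i.e. λ has at most b parts each at most a. -/
open scoped BigOperators

/-- A plane partition: a matrix of naturals (0-indexed) with weakly decreasing rows and
columns and finitely many nonzero entries. -/
structure PlanePartition where
  entry : ℕ → ℕ → ℕ
  row_decr : ∀ i j, entry i (j + 1) ≤ entry i j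
  col_decr : ∀ i j, entry (i + 1) j ≤ entry i j
  finite_support : {p : ℕ × ℕ | entry p.1 p.2 ≠ 0}.Finite

namespace PlanePartition

/-- `π` has at most `b` (nonzero) rows. -/
def rowsLE (π : PlanePartition) (b : ℕ) : Prop := ∀ i j, b ≤ i → π.entry i j = 0

/-- `π` has at most `a` (nonzero) columns. -/
def colsLE (π : PlanePartition) (a : ℕ) : Prop := ∀ i j, a ≤ j → π.entry i j = 0

/-- all entries of `π` are at most `c`. -/
def entriesLE (π : PlanePartition) (c : ℕ) : Prop := ∀ i j, π.entry i j ≤ c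

/-- the number of columns of `π` containing the entry `ℓ`. -/
noncomputable def cCol (π : PlanePartition) (ℓ : ℕ) : ℕ :=
  {j | ∃ i, π.entry i j = ℓ}.ncard

/-- the length of the `i`-th row of `π` (0-indexed); this is the `(i+1)`-st part of
the shape of `π`. -/
noncomputable def rowLen (π : PlanePartition) (i : ℕ) : ℕ :=
  {j | 0 < π.entry i j}.ncard

/-- `d_{iℓ} = #{j : π_{ij} = ℓ > π_{i+1,j}}`; the row index `i` is 0-indexed
while `ℓ` denotes the actual value. -/
noncomputable def phi (π : PlanePartition) (i ℓ : ℕ) : ℕ :=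
  {j | π.entry i j = ℓ ∧ π.entry (i + 1) j < ℓ}.ncard

/-- `Φ(π)` as a 0-indexed matrix: entry `(i, l)` counts `j` with `π_{ij} = l+1 > π_{i+1,j}`. -/
noncomputable def phiMatrix (π : PlanePartition) : ℕ → ℕ → ℕ :=
  fun i l => π.phi i (l + 1)

/-- `π` has shape `μ`. -/
def hasShape (π : PlanePartition) (μ : YoungDiagram) : Prop :=
  ∀ i j, 0 < π.entry i j ↔ (i, j) ∈ μ

/-- the descent set of `π` (0-indexed positions). -/
def des (π : PlanePartition) : Set (ℕ × ℕ) :=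
  {p | π.entry (p.1 + 1) p.2 < π.entry p.1 p.2}

end PlanePartition

/-- the set of plane partitions with at most `a` columns, at most `b` rows
and entries at most `c`. -/
def PP (a b c : ℕ) : Set PlanePartition :=
  {π | π.colsLE a ∧ π.rowsLE b ∧ π.entriesLE c}

/-- `PP(∞, b, c)`: plane partitions with at most `b` rows and entries at most `c`. -/
def PPinf (b c : ℕ) : Set PlanePartition :=
  {π | π.rowsLE b ∧ π.entriesLE c}

/-- a monotone lattice path (as a list of points) from `s` to `t`. -/
def IsMonPath (L : List (ℕ × ℕ)) (s t : ℕ × ℕ) : Prop :=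
  L.head? = some s ∧ L.getLast? = some t ∧
    L.Chain' fun p q => q = (p.1 + 1, p.2) ∨ q = (p.1, p.2 + 1)

/-- the last passage time: the maximal weight of a monotone path from `s` to `t`
in the matrix `d`. -/
noncomputable def lastPassage (d : ℕ → ℕ → ℕ) (s t : ℕ × ℕ) : ℕ :=
  sSup {n | ∃ L, IsMonPath L s t ∧ n = (L.map fun p => d p.1 p.2).sum}

/-- `b×c` matrices of naturals (as functions vanishing off `[0,b) × [0,c)`) whose
last passage time `G(b,c)` is at most `a`. -/
def BM (a b c : ℕ) : Set (ℕ → ℕ → ℕ) :=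
  {d | (∀ i j, b ≤ i → d i j = 0) ∧ (∀ i j, c ≤ j → d i j = 0) ∧
    lastPassage d (0, 0) (b - 1, c - 1) ≤ a}

/-- the rectangular Young diagram of the partition `(a^b)` (with `b` rows of length `a`). -/
def rectDiagram (a b : ℕ) : YoungDiagram where
  cells := Finset.range b ×ˢ Finset.range a
  isLowerSet := by
    intro p q hle hp
    simp only [Finset.coe_product, Set.mem_prod, Finset.mem_coe, Finset.mem_range] at hp ⊢
    exact ⟨lt_of_le_of_lt hle.1 hp.1, lt_of_le_of_lt hle.2 hp.2⟩

/-- the variables `(1^b, x_1, x_2, …)`: the first `b` variables are specialized to `1`. -/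
def oneExtend (b : ℕ) (x : ℕ → ℝ) : ℕ → ℝ :=
  fun i => if i < b then 1 else x (i - b)

/-- the Schur polynomial `s_μ(x_1, …, x_N)` evaluated at real arguments;
variables are 0-indexed (`x ℓ` is the variable `x_{ℓ+1}`), as are tableau entries. -/
noncomputable def schur (μ : YoungDiagram) (N : ℕ) (x : ℕ → ℝ) : ℝ :=
  ∑ᶠ T ∈ {T : SemistandardYoungTableau μ | ∀ i j, (i, j) ∈ μ → T i j < N},
    ∏ p ∈ μ.cells, x (T p.1 p.2)

/-- the dual symmetric Grothendieck polynomial `g_μ(x_1, …, x_n)` evaluated at real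
arguments; variables are 0-indexed (`x ℓ` is the variable `x_{ℓ+1}`). -/
noncomputable def grothG (μ : YoungDiagram) (n : ℕ) (x : ℕ → ℝ) : ℝ :=
  ∑ᶠ π ∈ {π : PlanePartition | π.hasShape μ ∧ π.entriesLE n},
    ∏ ℓ ∈ Finset.range n, x ℓ ^ π.cCol (ℓ + 1)

/-- the elementary symmetric polynomial `e_m(x_1, …, x_n)` evaluated at real arguments. -/
noncomputable def esym (n : ℕ) (x : ℕ → ℝ) (m : ℕ) : ℝ :=
  ∑ S ∈ (Finset.range n).powersetCard m, ∏ i ∈ S, x i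

/-- `e_m` for an integer index `m`, with `e_m = 0` for `m < 0`. -/
noncomputable def esymZ (n : ℕ) (x : ℕ → ℝ) (m : ℤ) : ℝ :=
  if 0 ≤ m then esym n x m.toNat else 0

/-- the weight `∏_{(i,j) ∈ Des(π)} q_{π_{ij}}`; the parameters are 0-indexed
(`q ℓ` is the parameter `q_{ℓ+1}`). -/
noncomputable def desWeight (π : PlanePartition) (q : ℕ → ℝ) : ℝ :=
  ∏ᶠ p ∈ π.des, q (π.entry p.1 p.2 - 1)

/-- the probability of a configuration `w` of a `b×c` matrix of i.i.d. Geom(q) entries,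
where `P(entry = k) = (1-q) qᵏ`. -/
noncomputable def geomWeight (q : ℝ) (b c : ℕ) (w : Fin b × Fin c → ℕ) : ℝ :=
  ∏ p : Fin b × Fin c, ((1 - q) * q ^ w p)

/-- extend a `b×c` matrix to an `ℕ × ℕ`-indexed matrix by zero. -/
def matExt {b c : ℕ} (w : Fin b × Fin c → ℕ) : ℕ → ℕ → ℕ :=
  fun i j => if h : i < b ∧ j < c then w (⟨i, h.1⟩, ⟨j, h.2⟩) else 0



/-- partitions inside the `b × a` rectangle, as row-length functions. -/
@[ext] structure Sh (a b : ℕ) where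
  f : ℕ → ℕ
  anti : ∀ i, f (i + 1) ≤ f i
  le : ∀ i, f i ≤ a
  zero : ∀ i, b ≤ i → f i = 0

namespace Sh

variable {a b : ℕ}

lemma finite_aux : Finite (Sh a b) := by
  apply Finite.of_injective
    (fun (s : Sh a b) => (fun i : Fin b => (⟨s.f i, Nat.lt_succ_of_le (s.le i)⟩ : Fin (a + 1))))
  intro s t h
  ext i
  by_cases hi : i < b
  · have := congrFun h ⟨i, hi⟩
    simpa using this
  · rw [s.zero i (by omega), t.zero i (by omega)]

noncomputable instance : Fintype (Sh a b) := @Fintype.ofFinite _ finite_aux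

noncomputable instance : DecidableEq (Sh a b) := Classical.decEq _

/-- the empty shape -/
def bot (a b : ℕ) : Sh a b := ⟨fun _ => 0, by simp, by simp, by simp⟩

/-- the rectangle -/
def top (a b : ℕ) : Sh a b :=
  ⟨fun i => if i < b then a else 0, by intro i; split_ifs <;> omega,
    by intro i; split_ifs <;> omega, by intro i hi; simp; omega⟩

lemma anti' (s : Sh a b) : Antitone s.f := antitone_nat_of_succ_le s.anti

end Sh

/-- length of the previous row -/
def prevRow (a : ℕ) (f : ℕ → ℕ) (i : ℕ) : ℕ := if i = 0 then a else f (i - 1)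

/-- number of columns of `n/l` -/
def colExp (a b : ℕ) (l n : ℕ → ℕ) : ℕ :=
  ∑ i ∈ Finset.range b, (min (n i) (prevRow a l i) - l i)

open Classical in
/-- hybrid transfer matrices -/
noncomputable def Vm (a b k : ℕ) (x : ℝ) : Matrix (Sh a b) (Sh a b) ℝ :=
  fun l n => if (∀ i, l.f i ≤ n.f i) ∧ (∀ i, k ≤ i + 1 → n.f (i + 1) ≤ l.f i) then
    x ^ colExp a b l.f n.f else 0

open Classical in
/-- add a horizontal strip in rows `≥ k` -/
noncomputable def Em (a b k : ℕ) : Matrix (Sh a b) (Sh a b) ℝ :=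
  fun l n => if (∀ i, l.f i ≤ n.f i) ∧ (∀ i, i < k → n.f i = l.f i) ∧
    (∀ i, k ≤ i + 1 → n.f (i + 1) ≤ l.f i) then 1 else 0

lemma toggle_weight (a b k : ℕ) (hk : 1 ≤ k) (m n p q : Sh a b)
    (h1 : ∀ i, i < k → p.f i = n.f i) (h2 : ∀ i, i < k → q.f i = m.f i)
    (h3 : ∀ i, k ≤ i → p.f i + q.f i = max (m.f i) (n.f (i+1)) + min (n.f i) (m.f (i-1)))
    (h4 : ∀ i, k ≤ i → max (m.f i) (n.f (i+1)) ≤ p.f i ∧ p.f i ≤ min (n.f i) (m.f (i-1))) :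
    colExp a b m.f p.f = colExp a b q.f n.f := by
  set D : ℕ → ℕ := fun i => if k < i then n.f i - m.f (i-1) else 0 with hD
  have key : ∀ N, ∑ i ∈ Finset.range N, (min (p.f i) (prevRow a m.f i) - m.f i)
      = ∑ i ∈ Finset.range N, (min (n.f i) (prevRow a q.f i) - q.f i) + D N := by
    intro N
    induction N with
    | zero => simp [hD]
    | succ N ih =>
      rw [Finset.sum_range_succ, Finset.sum_range_succ, ih]
      have : D N + (min (p.f N) (prevRow a m.f N) - m.f N)
          = (min (n.f N) (prevRow a q.f N) - q.f N) + D (N+1) := by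
        rcases lt_trichotomy N k with h | h | h
        · have e1 := h1 N h
          have e2 := h2 N h
          have e3 : prevRow a q.f N = prevRow a m.f N := by
            unfold prevRow
            split_ifs
            · rfl
            · exact h2 _ (by omega)
          have : ¬ k < N := by omega
          have : ¬ k < N + 1 := by omega
          simp [hD, *]
        · subst h
          have e3 : prevRow a q.f N = m.f (N-1) := by
            unfold prevRow
            rw [if_neg (by omega)]
            exact h2 _ (by omega)
          have e4 : prevRow a m.f N = m.f (N-1) := by
            unfold prevRow
            rw [if_neg (by omega)]
          have e5 := h3 N le_rfl
          have e6 := h4 N le_rfl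
          simp only [hD, e3, e4, lt_irrefl, if_false, Nat.lt_succ_self, if_true,
            Nat.add_sub_cancel]
          omega
        · obtain ⟨N, rfl⟩ : ∃ M, N = M + 1 := ⟨N - 1, by omega⟩
          have e3 : prevRow a q.f (N+1) = q.f N := by simp [prevRow]
          have e4 : prevRow a m.f (N+1) = m.f N := by simp [prevRow]
          have e5 := h3 (N+1) (by omega)
          have e6 := h4 (N+1) (by omega)
          have e7 := h3 N (by omega)
          have e8 := h4 N (by omega)
          have : k < N + 1 + 1 := by omega
          simp only [hD, e3, e4, h, this, if_true, Nat.add_sub_cancel] at *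
          omega
      omega
  have := key b
  have hb : D b = 0 := by simp [hD, n.zero b le_rfl]
  unfold colExp
  omega

lemma intertwine (a b k : ℕ) (hk : 1 ≤ k) (x : ℝ) :
    Vm a b k x * Em a b k = Em a b k * Vm a b (k+1) x := by
  classical
  ext m n
  rw [Matrix.mul_apply, Matrix.mul_apply]
  unfold Vm Em
  simp only [mul_ite, mul_one, mul_zero, ite_mul, one_mul, zero_mul, ← ite_and]
  rw [← Finset.sum_filter, ← Finset.sum_filter]
  have hP : ∀ p : Sh a b, (((∀ i, p.f i ≤ n.f i) ∧ (∀ i, i < k → n.f i = p.f i) ∧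
    (∀ i, k ≤ i + 1 → n.f (i + 1) ≤ p.f i)) ∧ (∀ i, m.f i ≤ p.f i) ∧
      (∀ i, k ≤ i + 1 → p.f (i + 1) ≤ m.f i)) ↔ ((∀ i, i < k → m.f i ≤ n.f i) ∧
      (∀ i, i < k → p.f i = n.f i) ∧ (∀ i, k ≤ i → max (m.f i) (n.f (i+1)) ≤ p.f i
        ∧ p.f i ≤ min (n.f i) (m.f (i-1)))) := by
    intro p
    constructor
    · rintro ⟨⟨h1, h2, h3⟩, h4, h5⟩
      refine ⟨fun i hi => (h4 i).trans (h1 i), fun i hi => (h2 i hi).symm, fun i hi => ?_⟩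
      have := h5 (i-1) (by omega)
      rw [Nat.sub_add_cancel (by omega)] at this
      exact ⟨max_le (h4 i) (h3 i (by omega)), le_min (h1 i) this⟩
    · rintro ⟨h1, h2, h3⟩
      refine ⟨⟨fun i => ?_, fun i hi => (h2 i hi).symm, fun i hi => ?_⟩, fun i => ?_,
        fun i hi => ?_⟩
      · rcases lt_or_ge i k with h | h
        · exact (h2 i h).le
        · have := h3 i h
          omega
      · rcases lt_or_ge i k with h | h
        · rw [h2 i h]; exact n.anti i
        · have := h3 i h
          omega
      · rcases lt_or_ge i k with h | h
        · rw [h2 i h]; exact h1 i h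
        · have := h3 i h
          omega
      · have := h3 (i+1) hi
        simp only [Nat.add_sub_cancel] at this
        omega
  have hQ : ∀ q : Sh a b, (((∀ i, m.f i ≤ q.f i) ∧ (∀ i, i < k → q.f i = m.f i) ∧
    (∀ i, k ≤ i + 1 → q.f (i + 1) ≤ m.f i)) ∧ (∀ i, q.f i ≤ n.f i) ∧
      (∀ i, k + 1 ≤ i + 1 → n.f (i + 1) ≤ q.f i)) ↔ ((∀ i, i < k → m.f i ≤ n.f i) ∧
      (∀ i, i < k → q.f i = m.f i) ∧ (∀ i, k ≤ i → max (m.f i) (n.f (i+1)) ≤ q.f i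
        ∧ q.f i ≤ min (n.f i) (m.f (i-1)))) := by
    intro q
    constructor
    · rintro ⟨⟨h1, h2, h3⟩, h4, h5⟩
      refine ⟨fun i hi => (h1 i).trans (h4 i), h2, fun i hi => ?_⟩
      have := h3 (i-1) (by omega)
      rw [Nat.sub_add_cancel (by omega)] at this
      exact ⟨max_le (h1 i) (h5 i (by omega)), le_min (h4 i) this⟩
    · rintro ⟨h1, h2, h3⟩
      refine ⟨⟨fun i => ?_, h2, fun i hi => ?_⟩, fun i => ?_,
        fun i hi => ?_⟩
      · rcases lt_or_ge i k with h | h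
        · exact (h2 i h).ge
        · have := h3 i h
          omega
      · have := h3 (i+1) hi
        simp only [Nat.add_sub_cancel] at this
        omega
      · rcases lt_or_ge i k with h | h
        · rw [h2 i h]; exact h1 i h
        · have := h3 i h
          omega
      · have := h3 i (by omega)
        omega
  have eP : (Finset.univ.filter fun p : Sh a b => ((∀ i, p.f i ≤ n.f i) ∧
      (∀ i, i < k → n.f i = p.f i) ∧
      (∀ i, k ≤ i + 1 → n.f (i + 1) ≤ p.f i)) ∧ (∀ i, m.f i ≤ p.f i) ∧
      (∀ i, k ≤ i + 1 → p.f (i + 1) ≤ m.f i)) = _ := Finset.filter_congr (fun p _ => hP p)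
  have eQ := Finset.filter_congr (s := (Finset.univ : Finset (Sh a b))) (fun q _ => and_comm.trans (hQ q))
  rw [eP, eQ]
  refine Finset.sum_bij'
    (fun p hp => ⟨fun i => if i < k then m.f i else
      max (m.f i) (n.f (i+1)) + min (n.f i) (m.f (i-1)) - p.f i, ?_, ?_, ?_⟩)
    (fun q hq => ⟨fun i => if i < k then n.f i else
      max (m.f i) (n.f (i+1)) + min (n.f i) (m.f (i-1)) - q.f i, ?_, ?_, ?_⟩)
    ?_ ?_ ?_ ?_ ?_
  · intro i
    obtain ⟨h1, h2, h3⟩ := (Finset.mem_filter.1 hp).2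
    have := m.anti i
    have e1 := h3 i
    have e2 := h3 (i+1)
    simp only [Nat.add_sub_cancel] at *
    split_ifs <;> omega
  · intro i
    obtain ⟨h1, h2, h3⟩ := (Finset.mem_filter.1 hp).2
    have := m.le i
    have := n.le i
    have e1 := h3 i
    split_ifs <;> omega
  · intro i hi
    have := m.zero i hi
    have := n.zero i hi
    have := n.zero (i+1) (by omega)
    split_ifs <;> omega
  · intro i
    obtain ⟨h1, h2, h3⟩ := (Finset.mem_filter.1 hq).2
    have := n.anti i
    have e1 := h3 i
    have e2 := h3 (i+1)
    simp only [Nat.add_sub_cancel] at *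
    split_ifs <;> omega
  · intro i
    obtain ⟨h1, h2, h3⟩ := (Finset.mem_filter.1 hq).2
    have := m.le i
    have := n.le i
    have e1 := h3 i
    split_ifs <;> omega
  · intro i hi
    have := m.zero i hi
    have := n.zero i hi
    have := n.zero (i+1) (by omega)
    split_ifs <;> omega
  · intro p hp
    obtain ⟨h1, h2, h3⟩ := (Finset.mem_filter.1 hp).2
    refine Finset.mem_filter.2 ⟨Finset.mem_univ _, h1, fun i hi => by simp [hi], fun i hi => ?_⟩
    have := h3 i hi
    have hi' : ¬ i < k := by omega
    simp only [hi', if_false]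
    omega
  · intro p hp
    obtain ⟨h1, h2, h3⟩ := (Finset.mem_filter.1 hp).2
    refine Finset.mem_filter.2 ⟨Finset.mem_univ _, h1, fun i hi => by simp [hi], fun i hi => ?_⟩
    have := h3 i hi
    have hi' : ¬ i < k := by omega
    simp only [hi', if_false]
    omega
  · intro p hp
    obtain ⟨h1, h2, h3⟩ := (Finset.mem_filter.1 hp).2
    ext i
    have e1 := h3 i
    have e2 := h2 i
    simp only
    split_ifs <;> omega
  · intro p hp
    obtain ⟨h1, h2, h3⟩ := (Finset.mem_filter.1 hp).2
    ext i
    have e1 := h3 i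
    have e2 := h2 i
    simp only
    split_ifs <;> omega
  · intro p hp
    obtain ⟨h1, h2, h3⟩ := (Finset.mem_filter.1 hp).2
    congr 1
    apply toggle_weight a b k hk m n p _ h2
    · intro i hi
      simp [hi]
    · intro i hi
      have := h3 i hi
      have hi' : ¬ i < k := by omega
      simp only [hi', if_false]
      omega
    · exact h3

/-- product of transfer matrices -/
noncomputable def chainM {a b : ℕ} : (ℕ → Matrix (Sh a b) (Sh a b) ℝ) → ℕ →
    Matrix (Sh a b) (Sh a b) ℝ
  | _, 0 => 1
  | K, (n+1) => chainM (fun l => K (l+1)) n * K 0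

lemma chainM_succ {a b : ℕ} (K : ℕ → Matrix (Sh a b) (Sh a b) ℝ) (n : ℕ) :
    chainM K (n+1) = chainM (fun l => K (l+1)) n * K 0 := rfl

/-- product of `E_k … E_{k+m-1}` -/
noncomputable def Am (a b : ℕ) : ℕ → ℕ → Matrix (Sh a b) (Sh a b) ℝ
  | _, 0 => 1
  | k, (m+1) => Em a b k * Am a b (k+1) m

lemma intertwine_A (a b : ℕ) (x : ℝ) (m : ℕ) : ∀ k, 1 ≤ k →
    Vm a b k x * Am a b k m = Am a b k m * Vm a b (k+m) x := by
  induction m with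
  | zero => intro k _; simp [Am]
  | succ m ih =>
    intro k hk
    rw [Am, ← Matrix.mul_assoc, intertwine a b k hk, Matrix.mul_assoc, ih (k+1) (by omega),
      Matrix.mul_assoc, show k + 1 + m = k + (m+1) by ring]

lemma chain_intertwine {a b : ℕ} (A : Matrix (Sh a b) (Sh a b) ℝ) (n : ℕ) :
    ∀ (K L : ℕ → Matrix (Sh a b) (Sh a b) ℝ), (∀ l, K l * A = A * L l) →
      chainM K n * A = A * chainM L n := by
  induction n with
  | zero => intro K L _; simp [chainM]
  | succ n ih =>
    intro K L h
    rw [chainM, chainM, Matrix.mul_assoc, h, ← Matrix.mul_assoc,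
      ih _ (fun l => L (l+1)) (fun l => h (l+1)), Matrix.mul_assoc]

lemma chain_add {a b : ℕ} (M : Matrix (Sh a b) (Sh a b) ℝ) (c n : ℕ) :
    ∀ (K : ℕ → Matrix (Sh a b) (Sh a b) ℝ), (∀ l, l < n → K l = M) →
      chainM K (n + c) = chainM (fun l => K (l + n)) c * M ^ n := by
  induction n with
  | zero => intro K _; simp
  | succ n ih =>
    intro K h
    rw [show n + 1 + c = (n + c) + 1 by ring, chainM, ih _ (fun l hl => h (l+1) (by omega)),
      h 0 (by omega), Matrix.mul_assoc, pow_succ]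
    simp only [add_assoc, add_comm 1 n]

lemma Em_bot (a b k : ℕ) (hk : 1 ≤ k) (n : Sh a b) :
    Em a b k (Sh.bot a b) n = if Sh.bot a b = n then 1 else 0 := by
  classical
  unfold Em
  refine if_congr ?_ rfl rfl
  constructor
  · rintro ⟨h1, h2, h3⟩
    ext i
    rcases lt_or_ge i k with h | h
    · exact (h2 i h).symm
    · have := h3 (i-1) (by omega)
      rw [Nat.sub_add_cancel (by omega)] at this
      simp only [Sh.bot] at *
      omega
  · rintro rfl
    simp [Sh.bot]

lemma Am_bot (a b m : ℕ) : ∀ k, 1 ≤ k → ∀ n : Sh a b,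
    Am a b k m (Sh.bot a b) n = if Sh.bot a b = n then 1 else 0 := by
  induction m with
  | zero => intro k _ n; simp [Am, Matrix.one_apply]
  | succ m ih =>
    intro k hk n
    rw [Am, Matrix.mul_apply]
    simp [Em_bot a b k hk, ih (k+1) (by omega)]

lemma Vm_one_eq (a b k : ℕ) (l n : Sh a b) [Decidable ((∀ i, l.f i ≤ n.f i) ∧
    (∀ i, k ≤ i + 1 → n.f (i + 1) ≤ l.f i))] :
    Vm a b k 1 l n = if (∀ i, l.f i ≤ n.f i) ∧
    (∀ i, k ≤ i + 1 → n.f (i + 1) ≤ l.f i) then 1 else 0 := by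
  unfold Vm
  simp only [one_pow]

lemma R_support (a b m : ℕ) : ∀ (t : Sh a b), (Vm a b 1 1 ^ m) t (Sh.top a b) ≠ 0 →
    ∀ i, i + m < b → t.f i = a := by
  classical
  induction m with
  | zero =>
    intro t ht i hi
    simp only [pow_zero, Matrix.one_apply, ne_eq, ite_eq_right_iff, one_ne_zero, imp_false,
      not_not] at ht
    rw [ht]
    simp [Sh.top]
    omega
  | succ m ih =>
    intro t ht i hi
    rw [pow_succ', Matrix.mul_apply] at ht
    obtain ⟨s, _, hs⟩ := Finset.exists_ne_zero_of_sum_ne_zero ht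
    have h1 := left_ne_zero_of_mul hs
    have h2 := ih s (right_ne_zero_of_mul hs) (i+1) (by omega)
    rw [Vm_one_eq] at h1
    have h3 : (∀ i, t.f i ≤ s.f i) ∧ (∀ i, 1 ≤ i + 1 → s.f (i + 1) ≤ t.f i) := by
      by_contra h
      exact h1 (if_neg h)
    have := h3.2 i (by omega)
    have := t.le i
    omega

/-- fill the first `k` rows -/
def fullSh {a b : ℕ} (k : ℕ) (hk : k ≤ b) (s : Sh a b) : Sh a b :=
  ⟨fun i => if i < k then a else s.f i, by
    intro i
    have := s.anti i
    have := s.le (i+1)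
    split_ifs <;> omega, by
    intro i
    have := s.le i
    split_ifs <;> omega, by
    intro i hi
    have := s.zero i hi
    split_ifs <;> omega⟩

lemma A_ones (a b m : ℕ) : ∀ k, (hk : k + 1 + m = b) → ∀ l : Sh a b,
    ∑ n, Am a b (k+1) m l n = (Vm a b 1 1 ^ (m+1)) (fullSh k (by omega) l) (Sh.top a b) := by
  classical
  induction m with
  | zero =>
    intro k hk l
    simp only [Am, Matrix.one_apply, Finset.sum_ite_eq, Finset.mem_univ, if_true]
    rw [zero_add, pow_one, Vm_one_eq, if_pos]
    constructor
    · intro i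
      have := l.le i
      have := l.zero i
      simp only [fullSh, Sh.top]
      split_ifs <;> omega
    · intro i _
      simp only [fullSh, Sh.top]
      split_ifs <;> omega
  | succ m ih =>
    intro k hk l
    rw [pow_succ', Matrix.mul_apply, Am]
    simp only [Matrix.mul_apply]
    rw [Finset.sum_comm]
    simp only [← Finset.mul_sum]
    simp only [ih (k+1) (by omega)]
    refine Finset.sum_bij_ne_zero (fun n _ _ => fullSh (k+1) (by omega) n)
      (fun _ _ _ => Finset.mem_univ _) ?_ ?_ ?_
    · intro n _ hn n' _ hn' e
      have h1 := left_ne_zero_of_mul hn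
      have h2 := left_ne_zero_of_mul hn'
      unfold Em at h1 h2
      simp only [ne_eq, ite_eq_right_iff, one_ne_zero, imp_false, not_not] at h1 h2
      ext i
      rcases lt_or_ge i (k+1) with h | h
      · rw [h1.2.1 i h, h2.2.1 i h]
      · have := congrFun (congrArg Sh.f e) i
        have h' : ¬ i < k + 1 := by omega
        simpa only [fullSh, h', if_false] using this
    · intro t _ ht
      have h1 := left_ne_zero_of_mul ht
      have h2 := R_support a b _ t (right_ne_zero_of_mul ht)
      rw [Vm_one_eq] at h1
      simp only [ne_eq, ite_eq_right_iff, one_ne_zero, imp_false, not_not] at h1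
      have hf : fullSh (k+1) (by omega) (⟨fun i => if i < k + 1 then l.f i else t.f i, by
          intro i
          have e1 := l.anti i
          have e2 := t.anti i
          have e3 := h1.2 i (by omega)
          simp only [fullSh] at e3
          split_ifs at * <;> omega, by
          intro i
          have e1 := l.le i
          have e2 := t.le i
          split_ifs at * <;> omega, by
          intro i hi
          have e1 := l.zero i hi
          have e2 := t.zero i hi
          split_ifs at * <;> omega⟩ : Sh a b) = t := by
        ext i
        simp only [fullSh]
        have := h2 i
        split_ifs <;> omega
      refine ⟨_, Finset.mem_univ _, ?_, hf⟩
      rw [hf]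
      refine mul_ne_zero ?_ (right_ne_zero_of_mul ht)
      unfold Em
      rw [if_pos]
      · exact one_ne_zero
      · refine ⟨fun i => ?_, fun i hi => by simp [hi], fun i hi => ?_⟩
        · have := h1.1 i
          simp only [fullSh] at *
          split_ifs at * <;> omega
        · have := h1.2 i (by omega)
          simp only [fullSh] at *
          split_ifs at * <;> omega
    · intro n _ hn
      have h1 := left_ne_zero_of_mul hn
      unfold Em at h1
      simp only [ne_eq, ite_eq_right_iff, one_ne_zero, imp_false, not_not] at h1
      congr 1
      rw [Vm_one_eq]
      unfold Em
      rw [if_pos h1, if_pos]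
      constructor
      · intro i
        have := h1.1 i
        have := l.le i
        simp only [fullSh]
        split_ifs at * <;> omega
      · intro i _
        have := h1.2.2 i
        have := n.le (i+1)
        simp only [fullSh]
        split_ifs at * <;> omega

lemma matrix_main (a b c : ℕ) (hb : 0 < b) (x : ℕ → ℝ) :
    ∑ n, chainM (fun l => Vm a b b (x l)) c (Sh.bot a b) n
      = chainM (fun l => Vm a b 1 (oneExtend b x l)) (b + c) (Sh.bot a b) (Sh.top a b) := by
  obtain ⟨m, rfl⟩ : ∃ m, b = m + 1 := ⟨b - 1, by omega⟩
  rw [chain_add (Vm a (m+1) 1 1) c (m+1) _ (fun l hl => by simp [oneExtend, hl])]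
  have e : (fun l => Vm a (m+1) 1 (oneExtend (m+1) x (l + (m+1))))
      = fun l => Vm a (m+1) 1 (x l) := by
    funext l
    have : ¬ l + (m+1) < m + 1 := by omega
    simp only [oneExtend, this, if_false, Nat.add_sub_cancel]
  rw [e]
  have h := chain_intertwine (Am a (m+1) 1 m) c (fun l => Vm a (m+1) 1 (x l))
    (fun l => Vm a (m+1) (m+1) (x l)) (fun l => by
      rw [intertwine_A a (m+1) (x l) m 1 le_rfl, add_comm 1 m])
  have h2 : ∀ n, chainM (fun l => Vm a (m+1) (m+1) (x l)) c (Sh.bot a (m+1)) n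
      = (chainM (fun l => Vm a (m+1) 1 (x l)) c * Am a (m+1) 1 m) (Sh.bot a (m+1)) n := by
    intro n
    rw [h, Matrix.mul_apply]
    simp [Am_bot a (m+1) m 1 le_rfl]
  simp only [h2, Matrix.mul_apply]
  rw [Finset.sum_comm]
  simp only [← Finset.mul_sum]
  apply Finset.sum_congr rfl
  intro l _
  congr 1
  have := A_ones a (m+1) m 0 (by omega) l
  simp only [zero_add] at this
  rw [this]
  congr 1
  

namespace PlanePartition

@[ext] lemma ext' {π ρ : PlanePartition} (h : ∀ i j, π.entry i j = ρ.entry i j) : π = ρ := by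
  cases π; cases ρ
  congr
  funext i j
  exact h i j

lemma row_anti (π : PlanePartition) (i : ℕ) : Antitone (π.entry i) :=
  antitone_nat_of_succ_le (π.row_decr i)

lemma col_anti (π : PlanePartition) (j : ℕ) : Antitone (fun i => π.entry i j) :=
  antitone_nat_of_succ_le (fun i => π.col_decr i j)

lemma exists_zero (π : PlanePartition) (i : ℕ) : ∃ j, π.entry i j = 0 := by
  by_contra h
  push Not at h
  have : (Set.range fun j : ℕ => (i, j)).Finite :=
    π.finite_support.subset (by rintro _ ⟨j, rfl⟩; exact h j)
  exact Set.infinite_range_of_injective (fun j j' e => by simpa using e) this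

/-- length of row `i` of `{π > k}` -/
noncomputable def layer (π : PlanePartition) (k i : ℕ) : ℕ :=
  Nat.find (p := fun j => π.entry i j ≤ k) (by
    obtain ⟨j, hj⟩ := π.exists_zero i
    exact ⟨j, by omega⟩)

lemma lt_layer (π : PlanePartition) (k i j : ℕ) : j < π.layer k i ↔ k < π.entry i j := by
  classical
  unfold layer
  rw [Nat.lt_find_iff]
  constructor
  · intro h
    have := h j le_rfl
    omega
  · intro h m hm
    have := π.row_anti i hm
    omega

/-- add one on the cells of `s` -/
def addSh {a b : ℕ} (s : Sh a b) (π : PlanePartition) : PlanePartition where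
  entry i j := π.entry i j + if j < s.f i then 1 else 0
  row_decr i j := by
    have := π.row_decr i j
    split_ifs <;> omega
  col_decr i j := by
    have := π.col_decr i j
    have := s.anti i
    split_ifs <;> omega
  finite_support := by
    apply (π.finite_support.union ((Finset.range b ×ˢ Finset.range a).finite_toSet)).subset
    rintro ⟨i, j⟩ h
    by_contra h'
    simp only [Set.mem_union, Set.mem_setOf_eq, Finset.coe_product, Finset.coe_range,
      Set.mem_prod, Set.mem_Iio, ne_eq] at h h'
    have := s.le i
    have := s.zero i
    split_ifs at h <;> omega

/-- subtract one everywhere -/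
def pred (π : PlanePartition) : PlanePartition where
  entry i j := π.entry i j - 1
  row_decr i j := Nat.sub_le_sub_right (π.row_decr i j) 1
  col_decr i j := Nat.sub_le_sub_right (π.col_decr i j) 1
  finite_support := π.finite_support.subset (by
    rintro ⟨i, j⟩ h
    simp only [Set.mem_setOf_eq] at *
    omega)

end PlanePartition

/-- plane partitions of shape `s` with entries at most `n` -/
def PPs {a b : ℕ} (s : Sh a b) (n : ℕ) : Set PlanePartition :=
  {π | (∀ i j, 0 < π.entry i j ↔ j < s.f i) ∧ π.entriesLE n}

lemma layer_zero_eq {a b : ℕ} {s : Sh a b} {n : ℕ} {π : PlanePartition} (h : π ∈ PPs s n) :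
    π.layer 0 = s.f := by
  funext i
  apply eq_of_forall_lt_iff
  intro j
  rw [π.lt_layer, h.1]

lemma layer_addSh {a b : ℕ} {s t : Sh a b} {n : ℕ} {π : PlanePartition} (h : π ∈ PPs t n)
    (hts : ∀ i, t.f i ≤ s.f i) (k : ℕ) :
    (π.addSh s).layer (k+1) = π.layer k := by
  funext i
  apply eq_of_forall_lt_iff
  intro j
  rw [PlanePartition.lt_layer, PlanePartition.lt_layer]
  have := h.1 i j
  have := hts i
  simp only [PlanePartition.addSh]
  split_ifs <;> omega

lemma addSh_mem {a b : ℕ} {s t : Sh a b} {n : ℕ} {π : PlanePartition} (h : π ∈ PPs t n)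
    (hts : ∀ i, t.f i ≤ s.f i) : π.addSh s ∈ PPs s (n+1) := by
  constructor
  · intro i j
    have := h.1 i j
    have := hts i
    simp only [PlanePartition.addSh]
    split_ifs <;> omega
  · intro i j
    have := h.2 i j
    simp only [PlanePartition.addSh]
    split_ifs <;> omega

lemma PPs_succ {a b : ℕ} (s : Sh a b) (n : ℕ) :
    PPs s (n+1) = ⋃ t ∈ {t : Sh a b | ∀ i, t.f i ≤ s.f i},
      (PlanePartition.addSh s) '' PPs t n := by
  ext π
  simp only [Set.mem_iUnion, Set.mem_image, Set.mem_setOf_eq]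
  constructor
  · intro h
    have hl : ∀ i, π.layer 1 i ≤ s.f i := by
      intro i
      by_contra hc
      push Not at hc
      rw [π.lt_layer] at hc
      have := (h.1 i (s.f i)).1 (by omega)
      omega
    refine ⟨⟨π.layer 1, ?_, ?_, ?_⟩, hl, π.pred, ⟨?_, ?_⟩, ?_⟩
    · intro i
      by_contra hc
      push Not at hc
      rw [π.lt_layer] at hc
      have h1 := π.col_decr i (π.layer 1 i)
      have h2 := π.lt_layer 1 i (π.layer 1 i)
      omega
    · exact fun i => (hl i).trans (s.le i)
    · intro i hi
      have := hl i
      have := s.zero i hi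
      omega
    · intro i j
      rw [π.lt_layer]
      simp only [PlanePartition.pred]
      omega
    · intro i j
      have := h.2 i j
      simp only [PlanePartition.pred]
      omega
    · ext i j
      have := h.1 i j
      simp only [PlanePartition.pred, PlanePartition.addSh]
      split_ifs <;> omega
  · rintro ⟨t, ht, ρ, hρ, rfl⟩
    exact addSh_mem hρ ht

lemma sum_PPs (a b n : ℕ) : ∀ (s : Sh a b) (K : ℕ → (ℕ → ℕ) → (ℕ → ℕ) → ℝ),
    (∀ l (t s : Sh a b), ¬ (∀ i, t.f i ≤ s.f i) → K l t.f s.f = 0) →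
    (PPs s n).Finite ∧
    ∑ᶠ π ∈ PPs s n, ∏ l ∈ Finset.range n, K l (π.layer (l+1)) (π.layer l)
      = chainM (fun l => Matrix.of (fun t s : Sh a b => K l t.f s.f)) n
          (Sh.bot a b) s := by
  induction n with
  | zero =>
    intro s K _
    by_cases hs : Sh.bot a b = s
    · subst hs
      have : PPs (Sh.bot a b) 0 = {⟨fun _ _ => 0, by simp, by simp, by simp⟩} := by
        ext π
        simp only [Set.mem_singleton_iff]
        constructor
        · intro h
          ext i j
          have := h.2 i j
          simpa using this
        · rintro rfl
          exact ⟨by simp [Sh.bot], fun i j => le_rfl⟩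
      rw [this]
      refine ⟨Set.finite_singleton _, ?_⟩
      rw [finsum_mem_singleton]
      simp [chainM]
    · have : PPs s 0 = ∅ := by
        ext π
        simp only [Set.mem_empty_iff_false, iff_false]
        intro h
        apply hs
        ext i
        have h1 := h.1 i 0
        have h2 := h.2 i 0
        simp only [Sh.bot]
        omega
      rw [this]
      refine ⟨Set.finite_empty, ?_⟩
      simp [chainM, Matrix.one_apply, hs]
  | succ n ih =>
    intro s K hK
    have hfin : ∀ t : Sh a b, (PPs t n).Finite := fun t => (ih t K hK).1
    have hfin' : ∀ t : Sh a b, (PlanePartition.addSh s '' PPs t n).Finite :=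
      fun t => (hfin t).image _
    have hinj : Function.Injective (PlanePartition.addSh s) := by
      intro π ρ e
      ext i j
      have := congrFun (congrFun (congrArg PlanePartition.entry e) i) j
      simpa [PlanePartition.addSh] using this
    rw [PPs_succ]
    refine ⟨(Set.toFinite _).biUnion (fun t _ => hfin' t), ?_⟩
    rw [finsum_mem_biUnion _ (Set.toFinite _) (fun t _ => hfin' t)]
    · rw [chainM_succ, Matrix.mul_apply, ← finsum_eq_sum_of_fintype]
      rw [finsum_mem_def]
      apply finsum_congr
      intro t
      by_cases ht : ∀ i, t.f i ≤ s.f i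
      · rw [Set.indicator_of_mem (by exact ht)]
        rw [finsum_mem_image hinj.injOn, ← (ih t (fun l => K (l+1)) (fun l => hK (l+1))).2,
          Matrix.of_apply, finsum_mem_mul' _ _ (hfin t)]
        apply finsum_mem_congr rfl
        intro π hπ
        rw [Finset.prod_range_succ']
        simp only [layer_addSh hπ ht]
        rw [layer_zero_eq (addSh_mem hπ ht), layer_zero_eq hπ]
      · rw [Set.indicator_of_notMem (by exact ht), Matrix.of_apply, hK 0 t s ht, mul_zero]
    · intro t _ t' _ htt
      rw [Function.onFun, Set.disjoint_left]
      rintro _ ⟨π, hπ, rfl⟩ ⟨ρ, hρ, e⟩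
      have := hinj e
      subst this
      apply htt
      ext1
      rw [← layer_zero_eq hπ, layer_zero_eq hρ]

open Classical in
/-- raw kernel of `Vm` -/
noncomputable def Kv (a b k : ℕ) (x : ℝ) (l n : ℕ → ℕ) : ℝ :=
  if (∀ i, l i ≤ n i) ∧ (∀ i, k ≤ i + 1 → n (i + 1) ≤ l i) then x ^ colExp a b l n else 0

lemma sum_Kv {a b : ℕ} (k n : ℕ) (x : ℕ → ℝ) (s : Sh a b) :
    ∑ᶠ π ∈ PPs s n, ∏ l ∈ Finset.range n, Kv a b k (x l) (π.layer (l+1)) (π.layer l)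
      = chainM (fun l => Vm a b k (x l)) n (Sh.bot a b) s := by
  refine (sum_PPs a b n s (fun l => Kv a b k (x l)) ?_).2
  intro l t s h
  unfold Kv
  rw [if_neg (fun h' => h h'.1)]

lemma layer_succ_le (π : PlanePartition) (l i : ℕ) : π.layer (l+1) i ≤ π.layer l i := by
  by_contra hc
  push Not at hc
  have h1 := (π.lt_layer (l+1) i _).1 hc
  have h2 := (π.lt_layer l i (π.layer l i))
  omega

lemma cCol_eq {a b : ℕ} {s : Sh a b} {n : ℕ} {π : PlanePartition} (h : π ∈ PPs s n) (l : ℕ) :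
    π.cCol (l+1) = colExp a b (π.layer (l+1)) (π.layer l) := by
  have hset : {j | ∃ i, π.entry i j = l+1} = (((Finset.range b).biUnion fun i =>
      Finset.Ico (π.layer (l+1) i) (min (π.layer l i) (prevRow a (π.layer (l+1)) i)) :
        Finset ℕ) : Set ℕ) := by
    ext j
    simp only [Set.mem_setOf_eq, Finset.coe_biUnion, Finset.coe_Ico, Set.mem_iUnion,
      Finset.coe_range, Set.mem_Iio, Set.mem_Ico, lt_min_iff, exists_prop]
    constructor
    · intro hj
      classical
      have h1 := Nat.find_spec hj
      have h2 := fun m => @Nat.find_min _ _ hj m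
      set i := Nat.find hj
      have h3 := (h.1 i j).1 (by omega)
      have h4 := s.zero i
      have h5 := s.le i
      refine ⟨i, by omega, ?_, ?_, ?_⟩
      · have := π.lt_layer (l+1) i j
        omega
      · rw [π.lt_layer]; omega
      · unfold prevRow
        split_ifs with hi
        · omega
        · rw [π.lt_layer]
          have e1 := π.col_decr (i-1) j
          rw [Nat.sub_add_cancel (by omega)] at e1
          have e2 := h2 (i-1) (by omega)
          omega
    · rintro ⟨i, hi, h1, h2, h3⟩
      refine ⟨i, ?_⟩
      rw [π.lt_layer] at h2
      have := π.lt_layer (l+1) i j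
      omega
  unfold PlanePartition.cCol colExp
  rw [hset, Set.ncard_coe_finset, Finset.card_biUnion]
  · simp
  · have key : ∀ i i', i < i' → Disjoint
        (Finset.Ico (π.layer (l+1) i) (min (π.layer l i) (prevRow a (π.layer (l+1)) i)))
        (Finset.Ico (π.layer (l+1) i') (min (π.layer l i') (prevRow a (π.layer (l+1)) i'))) := by
      intro i i' hii
      rw [Finset.disjoint_left]
      intro j hj hj'
      simp only [Finset.mem_Ico, lt_min_iff] at hj hj'
      have h1 := hj'.2.2
      unfold prevRow at h1
      rw [if_neg (by omega), π.lt_layer] at h1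
      have h2 := π.col_anti j (show i ≤ i' - 1 by omega)
      have h3 := π.lt_layer (l+1) i j
      simp only at h2
      omega
    intro i _ i' _ hne
    rcases lt_or_gt_of_ne hne with h | h
    · exact key _ _ h
    · exact (key _ _ h).symm

/-- the Young diagram of a shape -/
def ydSh {a b : ℕ} (s : Sh a b) : YoungDiagram where
  cells := (Finset.range b ×ˢ Finset.range a).filter fun p => p.2 < s.f p.1
  isLowerSet := by
    rintro ⟨i, j⟩ ⟨i', j'⟩ ⟨h1, h2⟩ hp
    simp only [Finset.coe_filter, Finset.mem_product, Finset.mem_range, Set.mem_setOf_eq] at *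
    have := s.anti' h1
    omega

lemma mem_ydSh {a b : ℕ} (s : Sh a b) (i j : ℕ) : (i, j) ∈ ydSh s ↔ j < s.f i := by
  rw [← YoungDiagram.mem_cells]
  simp only [ydSh, Finset.mem_filter, Finset.mem_product, Finset.mem_range]
  have := s.zero i
  have := s.le i
  omega

lemma mem_rect (a b i j : ℕ) : (i, j) ∈ rectDiagram a b ↔ i < b ∧ j < a := by
  rw [← YoungDiagram.mem_cells]
  simp [rectDiagram]

lemma groth_eq {a b : ℕ} (c : ℕ) (x : ℕ → ℝ) (s : Sh a b) :
    grothG (ydSh s) c x = chainM (fun l => Vm a b b (x l)) c (Sh.bot a b) s := by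
  rw [← sum_Kv]
  unfold grothG
  apply finsum_mem_congr
  · ext π
    simp only [PPs, PlanePartition.hasShape, mem_ydSh]
  · intro π hπ
    apply Finset.prod_congr rfl
    intro l _
    unfold Kv
    rw [if_pos, cCol_eq hπ]
    refine ⟨layer_succ_le π l, fun i hi => ?_⟩
    by_contra hc
    push Not at hc
    rw [π.lt_layer] at hc
    have := (hπ.1 (i+1) (π.layer (l+1) i)).1 (by omega)
    have := s.zero (i+1) hi
    omega

lemma ydSh_bij (a b : ℕ) : Set.BijOn (ydSh : Sh a b → YoungDiagram) Set.univ
    {μ | μ ≤ rectDiagram a b} := by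
  refine ⟨?_, ?_, ?_⟩
  · intro s _
    rintro ⟨i, j⟩ h
    have h := (mem_ydSh s i j).1 h
    refine (mem_rect a b i j).2 ?_
    have := s.zero i
    have := s.le i
    omega
  · intro s _ t _ e
    ext i
    apply eq_of_forall_lt_iff
    intro j
    rw [← mem_ydSh, ← mem_ydSh, e]
  · intro μ hμ
    have hμ' : ∀ i j, j < μ.rowLen i → i < b ∧ j < a := by
      intro i j h
      rw [← YoungDiagram.mem_iff_lt_rowLen] at h
      exact (mem_rect a b i j).1 (hμ h)
    refine ⟨⟨μ.rowLen, fun i => μ.rowLen_anti _ _ (Nat.le_succ i), fun i => ?_, fun i hi => ?_⟩,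
      Set.mem_univ _, ?_⟩
    · by_contra hc
      have := hμ' i a (by omega)
      omega
    · by_contra hc
      have := hμ' i 0 (by omega)
      omega
    · ext ⟨i, j⟩
      rw [YoungDiagram.mem_cells, YoungDiagram.mem_cells, mem_ydSh,
        YoungDiagram.mem_iff_lt_rowLen]

lemma lhs_eq (a b c : ℕ) (x : ℕ → ℝ) :
    ∑ᶠ μ ∈ {μ : YoungDiagram | μ ≤ rectDiagram a b}, grothG μ c x
      = ∑ n, chainM (fun l => Vm a b b (x l)) c (Sh.bot a b) n := by
  rw [← finsum_eq_sum_of_fintype,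
    ← finsum_mem_univ (fun s => chainM (fun l => Vm a b b (x l)) c (Sh.bot a b) s)]
  exact (finsum_mem_eq_of_bijOn (f := fun s => chainM (fun l => Vm a b b (x l)) c (Sh.bot a b) s)
    (g := fun μ => grothG μ c x) ydSh (ydSh_bij a b) (fun s _ => (groth_eq c x s).symm)).symm

/-- rotate a rectangular tableau to a plane partition -/
def rotPP {a b : ℕ} (T : SemistandardYoungTableau (rectDiagram a b)) : PlanePartition where
  entry i j := if i < b ∧ j < a then T (b - 1 - i) (a - 1 - j) + 1 else 0
  row_decr i j := by
    split_ifs with h1 h2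
    · have := T.row_weak (i := b-1-i) (j1 := a-1-(j+1)) (j2 := a-1-j) (by omega)
        ((mem_rect _ _ _ _).2 (by omega))
      omega
    all_goals omega
  col_decr i j := by
    split_ifs with h1 h2
    · have := T.col_strict (i1 := b-1-(i+1)) (i2 := b-1-i) (j := a-1-j) (by omega)
        ((mem_rect _ _ _ _).2 (by omega))
      omega
    all_goals omega
  finite_support := by
    apply ((Finset.range b ×ˢ Finset.range a).finite_toSet).subset
    rintro ⟨i, j⟩ h
    simp only [Set.mem_setOf_eq, ne_eq, ite_eq_right_iff, not_forall] at h
    simpa using h.1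

/-- column-strict plane partitions of rectangular shape -/
def strictSet (a b N : ℕ) : Set PlanePartition :=
  {π | π ∈ PPs (Sh.top a b) N ∧ ∀ i j, 0 < π.entry (i+1) j → π.entry (i+1) j < π.entry i j}

lemma top_lt (a b i j : ℕ) : j < (Sh.top a b).f i ↔ i < b ∧ j < a := by
  simp only [Sh.top]
  split_ifs <;> omega

lemma rot_bij (a b N : ℕ) : Set.BijOn (rotPP : SemistandardYoungTableau (rectDiagram a b) → _)
    {T | ∀ i j, (i, j) ∈ rectDiagram a b → T i j < N} (strictSet a b N) := by
  refine ⟨?_, ?_, ?_⟩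
  · intro T hT
    refine ⟨⟨fun i j => ?_, fun i j => ?_⟩, fun i j => ?_⟩
    · rw [top_lt]
      simp only [rotPP]
      split_ifs with h
      · simp [h]
      · simp [h]
    · simp only [rotPP]
      split_ifs with h
      · exact hT _ _ ((mem_rect _ _ _ _).2 (by omega))
      · omega
    · simp only [rotPP]
      split_ifs with h1 h2
      · intro _
        have := T.col_strict (i1 := b-1-(i+1)) (i2 := b-1-i) (j := a-1-j) (by omega)
          ((mem_rect _ _ _ _).2 (by omega))
        omega
      all_goals omega
  · intro T _ T' _ e
    ext i j
    by_cases h : i < b ∧ j < a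
    · have := congrFun (congrFun (congrArg PlanePartition.entry e) (b-1-i)) (a-1-j)
      simp only [rotPP] at this
      rw [if_pos (by omega), if_pos (by omega), show b - 1 - (b-1-i) = i by omega,
        show a - 1 - (a-1-j) = j by omega] at this
      omega
    · rw [T.zeros (by rw [mem_rect]; exact h), T'.zeros (by rw [mem_rect]; exact h)]
  · intro π hπ
    obtain ⟨⟨h1, h2⟩, h3⟩ := hπ
    simp only [top_lt] at h1
    have h4 : ∀ d i j, 0 < d → 0 < π.entry (i+d) j → π.entry (i+d) j < π.entry i j := by
      intro d i j hd hp
      have e1 := h3 i j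
      have e2 := π.col_anti j (show i + 1 ≤ i + d by omega)
      simp only at e2
      omega
    refine ⟨⟨fun i j => if i < b ∧ j < a then π.entry (b-1-i) (a-1-j) - 1 else 0, ?_, ?_, ?_⟩,
      ?_, ?_⟩
    · intro i j1 j2 hj hm
      rw [mem_rect] at hm
      rw [if_pos (by omega), if_pos hm]
      exact Nat.sub_le_sub_right (π.row_anti _ (by omega)) 1
    · intro i1 i2 j hi hm
      rw [mem_rect] at hm
      rw [if_pos (by omega), if_pos hm]
      have := h4 (i2 - i1) (b-1-i2) (a-1-j) (by omega)
      rw [show b - 1 - i2 + (i2 - i1) = b - 1 - i1 by omega] at this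
      have e := (h1 (b-1-i1) (a-1-j)).2 (by omega)
      have := this e
      omega
    · intro i j hm
      rw [mem_rect] at hm
      rw [if_neg hm]
    · intro i j hm
      rw [mem_rect] at hm
      change (if i < b ∧ j < a then π.entry (b-1-i) (a-1-j) - 1 else 0) < N
      rw [if_pos hm]
      have e := (h1 (b-1-i) (a-1-j)).2 (by omega)
      have := h2 (b-1-i) (a-1-j)
      omega
    · ext i j
      change (if i < b ∧ j < a then (if b - 1 - i < b ∧ a - 1 - j < a then
        π.entry (b-1-(b-1-i)) (a-1-(a-1-j)) - 1 else 0) + 1 else 0) = π.entry i j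
      have e := h1 i j
      by_cases h : i < b ∧ j < a
      · rw [if_pos h, if_pos (by omega), show b - 1 - (b-1-i) = i by omega,
          show a - 1 - (a-1-j) = j by omega]
        omega
      · rw [if_neg h]
        omega

lemma strict_weight {a b N : ℕ} (y : ℕ → ℝ) {π : PlanePartition} (hπ : π ∈ strictSet a b N) :
    ∏ i ∈ Finset.range b, ∏ j ∈ Finset.range a, y (π.entry i j - 1)
      = ∏ l ∈ Finset.range N, Kv a b 1 (y l) (π.layer (l+1)) (π.layer l) := by
  obtain ⟨⟨h1, h2⟩, h3⟩ := hπ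
  simp only [top_lt] at h1
  have hst : ∀ l i, π.layer l (i+1) ≤ π.layer (l+1) i := by
    intro l i
    by_contra hc
    push Not at hc
    rw [π.lt_layer] at hc
    have e1 := h3 i _ (by omega : 0 < π.entry (i+1) (π.layer (l+1) i))
    have e2 := π.lt_layer (l+1) i (π.layer (l+1) i)
    omega
  have hla : ∀ l i, π.layer l i ≤ a := by
    intro l i
    by_contra hc
    push Not at hc
    rw [π.lt_layer] at hc
    have := (h1 i a).1 (by omega)
    omega
  have hK : ∀ l, Kv a b 1 (y l) (π.layer (l+1)) (π.layer l)
      = ∏ i ∈ Finset.range b, y l ^ (π.layer l i - π.layer (l+1) i) := by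
    intro l
    unfold Kv
    rw [if_pos ⟨layer_succ_le π l, fun i _ => hst l i⟩, Finset.prod_pow_eq_pow_sum]
    congr 1
    unfold colExp
    apply Finset.sum_congr rfl
    intro i _
    congr 1
    apply min_eq_left
    unfold prevRow
    split_ifs with h
    · exact hla l i
    · have := hst l (i-1)
      rwa [Nat.sub_add_cancel (by omega)] at this
  simp only [hK]
  rw [Finset.prod_comm (s := Finset.range N)]
  apply Finset.prod_congr rfl
  intro i hi
  rw [Finset.mem_range] at hi
  rw [← Finset.prod_fiberwise_of_maps_to (s := Finset.range a) (t := Finset.range N)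
    (g := fun j => π.entry i j - 1)]
  · apply Finset.prod_congr rfl
    intro l _
    rw [Finset.prod_congr rfl (g := fun _ => y l)]
    · rw [Finset.prod_const]
      congr 1
      rw [← Nat.card_Ico]
      congr 1
      ext j
      simp only [Finset.mem_filter, Finset.mem_range, Finset.mem_Ico]
      have e1 := π.lt_layer (l+1) i j
      have e2 := π.lt_layer l i j
      have e3 := h1 i j
      omega
    · intro j hj
      rw [(Finset.mem_filter.1 hj).2]
  · intro j hj
    rw [Finset.mem_range] at *
    have e3 := h1 i j
    have e4 := h2 i j
    omega

lemma rhs_eq (a b N : ℕ) (y : ℕ → ℝ) :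
    schur (rectDiagram a b) N y
      = chainM (fun l => Vm a b 1 (y l)) N (Sh.bot a b) (Sh.top a b) := by
  rw [← sum_Kv]
  have h1 : schur (rectDiagram a b) N y = ∑ᶠ π ∈ strictSet a b N,
      ∏ l ∈ Finset.range N, Kv a b 1 (y l) (π.layer (l+1)) (π.layer l) := by
    unfold schur
    refine finsum_mem_eq_of_bijOn rotPP (rot_bij a b N) (fun T hT => ?_)
    rw [← strict_weight y ((rot_bij a b N).mapsTo hT)]
    change ∏ p ∈ Finset.range b ×ˢ Finset.range a, y (T p.1 p.2) = _
    rw [Finset.prod_product, ← Finset.prod_range_reflect]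
    apply Finset.prod_congr rfl
    intro i hi
    rw [← Finset.prod_range_reflect]
    apply Finset.prod_congr rfl
    intro j hj
    rw [Finset.mem_range] at hi hj
    simp [rotPP, hi, hj]
  rw [h1]
  apply finsum_mem_inter_support_eq
  ext π
  constructor
  · rintro ⟨h, h'⟩
    exact ⟨h.1, h'⟩
  · rintro ⟨h, h'⟩
    refine ⟨⟨h, fun i j hp => ?_⟩, h'⟩
    rw [Function.mem_support, Finset.prod_ne_zero_iff] at h'
    have hN := h.2 (i+1) j
    have := h' (π.entry (i+1) j - 1) (Finset.mem_range.2 (by omega))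
    unfold Kv at this
    have h2 : (π.layer (π.entry (i+1) j - 1) (i+1)) ≤ (π.layer (π.entry (i+1) j - 1 + 1) i) := by
      by_contra hc
      exact this (if_neg (fun hh => hc (hh.2 i (by omega))))
    have h3 := (π.lt_layer (π.entry (i+1) j - 1) (i+1) j).2 (by omega)
    have h4 := (π.lt_layer _ i j).1 (lt_of_lt_of_le h3 h2)
    omega

/-- `∑_{λ ⊆ (a^b)} g_λ(x_1,…,x_c) = s_{(a^b)}(1^b, x_1,…,x_c)`,
the sum over all partitions whose diagram fits in the `b × a` rectangle. -/
theorem sum_grothG_eq_schur (a b c : ℕ) (ha : 0 < a) (hb : 0 < b) (hc : 0 < c)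
    (x : ℕ → ℝ) :
    ∑ᶠ μ ∈ {μ : YoungDiagram | μ ≤ rectDiagram a b}, grothG μ c x
      = schur (rectDiagram a b) (b + c) (oneExtend b x) := by
  rw [lhs_eq, rhs_eq]
  exact matrix_main a b c hb x
end

section
/- Let b, c be positive integers and q_1,…,q_c ∈ [0,1). Then the family (g_λ(q_1,…,q_c)) indexed by all partitions λ with at most b parts is summable, and ∑_{λ : ℓ(λ) ≤ b} g_λ(q_1,…,q_c) = ∏_{i=1}^{c} (1 − q_i)^{−b}. -/
open scoped BigOperators

theorem aux_hasSum_fin : ∀ (n : ℕ) (f : Fin n → ℕ → ℝ) (a : Fin n → ℝ)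
    (_ : ∀ i k, 0 ≤ f i k) (_ : ∀ i, HasSum (f i) (a i)),
    HasSum (fun w : Fin n → ℕ => ∏ i, f i (w i)) (∏ i, a i)
  | 0, f, a, _, _ => by
    simpa using hasSum_unique (fun w : Fin 0 → ℕ => ∏ i, f i (w i))
  | n + 1, f, a, h0, h => by
    have ih := aux_hasSum_fin n (fun i => f i.succ) (fun i => a i.succ)
      (fun i k => h0 _ _) (fun i => h _)
    have hs := (h 0).summable.mul_of_nonneg ih.summable (fun k => h0 _ _)
      (fun w => Finset.prod_nonneg fun i _ => h0 _ _)
    have := (h 0).mul ih hs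
    rw [Fin.prod_univ_succ, ← (Fin.consEquiv (fun _ : Fin (n + 1) => ℕ)).hasSum_iff]
    refine this.congr_fun ?_
    intro x
    simp [Fin.prod_univ_succ, Fin.consEquiv]

theorem aux_hasSum {ι : Type} [Fintype ι] (f : ι → ℕ → ℝ) (a : ι → ℝ)
    (h0 : ∀ i k, 0 ≤ f i k) (h : ∀ i, HasSum (f i) (a i)) :
    HasSum (fun w : ι → ℕ => ∏ i, f i (w i)) (∏ i, a i) := by
  let e := Fintype.equivFin ι
  have := aux_hasSum_fin _ (fun i => f (e.symm i)) (fun i => a (e.symm i))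
    (fun i k => h0 _ _) (fun i => h _)
  rw [e.symm.prod_comp a] at this
  rw [← (e.symm.arrowCongr (Equiv.refl ℕ)).hasSum_iff]
  convert this using 1
  funext w
  simp only [Function.comp]
  rw [← e.symm.prod_comp]
  simp [Equiv.arrowCongr]

theorem aux_row (π : PlanePartition) (i : ℕ) : Antitone (π.entry i) :=
  antitone_nat_of_succ_le (π.row_decr i)

theorem aux_col (π : PlanePartition) (j : ℕ) : Antitone (fun i => π.entry i j) :=
  antitone_nat_of_succ_le (fun i => π.col_decr i j)

def AuxG (π : PlanePartition) (G : ℕ → ℕ → ℕ) : Prop :=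
  ∀ i j l, l < π.entry i j ↔ j < G i l

theorem aux_exists_G (π : PlanePartition) : ∃ G, AuxG π G := by
  have key : ∀ i l, ∃ m, ∀ j, l < π.entry i j ↔ j < m := by
    intro i l
    have hex : ∃ m, π.entry i m ≤ l := by
      by_contra! hcon
      have hinj : Function.Injective (fun j : ℕ => (i, j)) := fun a b h => by simpa using h
      refine Set.infinite_univ (α := ℕ)
        ((π.finite_support.preimage hinj.injOn).subset ?_)
      intro j _
      have := hcon j
      simp only [Set.mem_preimage, Set.mem_setOf_eq]
      omega
    classical
    refine ⟨Nat.find hex, fun j => ⟨fun h => ?_, fun h => ?_⟩⟩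
    · by_contra! hcon
      have h1 := aux_row π i hcon
      have h2 := Nat.find_spec hex
      omega
    · have := Nat.find_min hex h
      omega
  choose G hG using key
  exact ⟨G, fun i j l => hG i l j⟩

theorem aux_le1 {π : PlanePartition} {G} (hG : AuxG π G) (i l : ℕ) : G i (l + 1) ≤ G i l := by
  by_contra! h
  have h1 := (hG i (G i l) (l + 1)).2 h
  have h2 := (hG i (G i l) l).1 (by omega)
  omega

theorem aux_le2 {π : PlanePartition} {G} (hG : AuxG π G) (i l : ℕ) : G (i + 1) l ≤ G i l := by
  by_contra! h
  have h1 := (hG (i + 1) (G i l) l).2 h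
  have h2 := (hG i (G i l) l).1 (lt_of_lt_of_le h1 (π.col_decr _ _))
  omega

theorem aux_set {π : PlanePartition} {G} (hG : AuxG π G) (i l : ℕ) :
    {j | π.entry i j = l + 1 ∧ π.entry (i + 1) j < l + 1} =
      ↑(Finset.Ico (max (G i (l + 1)) (G (i + 1) l)) (G i l)) := by
  ext j
  have h1 := hG i j l
  have h2 := hG i j (l + 1)
  have h3 := hG (i + 1) j l
  simp only [Set.mem_setOf_eq, Finset.coe_Ico, Set.mem_Ico, max_le_iff]
  omega

theorem aux_phi {π : PlanePartition} {G} (hG : AuxG π G) (i l : ℕ) :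
    π.phi i (l + 1) = G i l - max (G i (l + 1)) (G (i + 1) l) := by
  unfold PlanePartition.phi
  rw [aux_set hG, Set.ncard_coe_finset, Nat.card_Ico]

theorem aux_G_zero {π : PlanePartition} {G} (hG : AuxG π G) {b c : ℕ} (h : π ∈ PPinf b c)
    (i l : ℕ) (hil : b ≤ i ∨ c ≤ l) : G i l = 0 := by
  by_contra hne
  have h1 := (hG i 0 l).2 (by omega)
  rcases hil with hi | hl
  · have := h.1 i 0 hi
    omega
  · have := h.2 i 0
    omega

theorem aux_inj {π π' : PlanePartition} {b c : ℕ} (h : π ∈ PPinf b c) (h' : π' ∈ PPinf b c)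
    (heq : ∀ i < b, ∀ l < c, π.phi i (l + 1) = π'.phi i (l + 1)) : π = π' := by
  obtain ⟨G, hG⟩ := aux_exists_G π
  obtain ⟨G', hG'⟩ := aux_exists_G π'
  have key : ∀ n i l, (b - i) + (c - l) = n → G i l = G' i l := by
    intro n
    induction n using Nat.strong_induction_on with
    | _ n ih =>
      intro i l hn
      by_cases hil : i < b ∧ l < c
      · have e1 := ih _ (by omega) i (l + 1) rfl
        have e2 := ih _ (by omega) (i + 1) l rfl
        have e3 := heq i hil.1 l hil.2
        rw [aux_phi hG, aux_phi hG', e1, e2] at e3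
        have a1 := aux_le1 hG i l
        have a2 := aux_le2 hG i l
        have a3 := aux_le1 hG' i l
        have a4 := aux_le2 hG' i l
        omega
      · rw [aux_G_zero hG h i l (by omega), aux_G_zero hG' h' i l (by omega)]
  have hent : π.entry = π'.entry := by
    funext i j
    refine eq_of_forall_lt_iff fun l => ?_
    rw [hG i j l, hG' i j l, key _ i l rfl]
  cases π
  cases π'
  simpa using hent

/-- last passage recursion -/
def auxLP (b c : ℕ) (d : ℕ → ℕ → ℕ) (i l : ℕ) : ℕ :=
  if _h : i < b ∧ l < c then
    d i l + max (auxLP b c d i (l + 1)) (auxLP b c d (i + 1) l)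
  else 0
termination_by (b - i) + (c - l)

theorem auxLP_pos {b c : ℕ} (d : ℕ → ℕ → ℕ) {i l : ℕ} (h : i < b ∧ l < c) :
    auxLP b c d i l = d i l + max (auxLP b c d i (l + 1)) (auxLP b c d (i + 1) l) := by
  rw [auxLP, dif_pos h]

theorem auxLP_neg {b c : ℕ} (d : ℕ → ℕ → ℕ) {i l : ℕ} (h : ¬ (i < b ∧ l < c)) :
    auxLP b c d i l = 0 := by
  rw [auxLP, dif_neg h]

theorem auxLP_le1 (b c : ℕ) (d : ℕ → ℕ → ℕ) (i l : ℕ) :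
    auxLP b c d i (l + 1) ≤ auxLP b c d i l := by
  by_cases h : i < b ∧ l < c
  · rw [auxLP_pos d h]; omega
  · rw [auxLP_neg d (by omega : ¬ (i < b ∧ l + 1 < c))]; omega

theorem auxLP_le2 (b c : ℕ) (d : ℕ → ℕ → ℕ) (i l : ℕ) :
    auxLP b c d (i + 1) l ≤ auxLP b c d i l := by
  by_cases h : i < b ∧ l < c
  · rw [auxLP_pos d h]; omega
  · rw [auxLP_neg d (by omega : ¬ (i + 1 < b ∧ l < c))]; omega

theorem aux_card (f : ℕ → ℕ) (hf : Antitone f) (c j l : ℕ) :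
    l < ((Finset.range c).filter fun k => j < f k).card ↔ l < c ∧ j < f l := by
  constructor
  · intro h
    by_contra hcon
    have hsub : ((Finset.range c).filter fun k => j < f k) ⊆ Finset.range l := by
      intro k hk
      simp only [Finset.mem_filter, Finset.mem_range] at hk ⊢
      by_contra! hlk
      have := hf hlk
      omega
    have := Finset.card_le_card hsub
    rw [Finset.card_range] at this
    omega
  · rintro ⟨h1, h2⟩
    have hsub : Finset.range (l + 1) ⊆ ((Finset.range c).filter fun k => j < f k) := by
      intro k hk
      simp only [Finset.mem_filter, Finset.mem_range] at hk ⊢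
      have := hf (by omega : k ≤ l)
      omega
    have := Finset.card_le_card hsub
    rw [Finset.card_range] at this
    omega

theorem aux_surj (b c : ℕ) (d : ℕ → ℕ → ℕ) :
    ∃ π ∈ PPinf b c, ∀ i < b, ∀ l < c, π.phi i (l + 1) = d i l := by
  set G := auxLP b c d with hGdef
  have m1 : ∀ i, Antitone (G i) := fun i => antitone_nat_of_succ_le (auxLP_le1 b c d i)
  have m2 : ∀ l, Antitone (fun i => G i l) :=
    fun l => antitone_nat_of_succ_le (fun i => auxLP_le2 b c d i l)
  have hz : ∀ i l, ¬ (i < b ∧ l < c) → G i l = 0 := fun i l h => auxLP_neg d h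
  let π : PlanePartition :=
    { entry := fun i j => ((Finset.range c).filter fun k => j < G i k).card
      row_decr := by
        intro i j
        refine Finset.card_le_card (Finset.monotone_filter_right _ ?_)
        intro k _ hk
        omega
      col_decr := by
        intro i j
        refine Finset.card_le_card (Finset.monotone_filter_right _ ?_)
        intro k _ hk
        exact lt_of_lt_of_le hk (auxLP_le2 b c d i k)
      finite_support := by
        refine ((Set.finite_Iio b).prod (Set.finite_Iio (G 0 0))).subset ?_
        rintro ⟨i, j⟩ hp
        simp only [Set.mem_setOf_eq] at hp
        have := (aux_card (G i) (m1 i) c j 0).1 (Nat.pos_of_ne_zero hp)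
        have h1 : G i 0 ≤ G 0 0 := m2 0 (Nat.zero_le i)
        simp only [Set.mem_prod, Set.mem_Iio]
        refine ⟨?_, by omega⟩
        by_contra hib
        have := hz i 0 (by omega)
        omega }
  have hG : AuxG π G := by
    intro i j l
    refine (aux_card (G i) (m1 i) c j l).trans ⟨fun h => h.2, fun h => ⟨?_, h⟩⟩
    by_contra hlc
    have := hz i l (by omega)
    omega
  refine ⟨π, ⟨fun i j hi => ?_, fun i j => ?_⟩, fun i hi l hl => ?_⟩
  · by_contra hne
    have h1 := (hG i j 0).1 (by omega)
    have := hz i 0 (by omega)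
    omega
  · by_contra! hne
    have h1 := (hG i j c).1 hne
    have := hz i c (by omega)
    omega
  · rw [aux_phi hG, hGdef, auxLP_pos d ⟨hi, hl⟩]
    omega

theorem aux_cCol {π : PlanePartition} {b : ℕ} (h : π.rowsLE b) (l : ℕ) :
    π.cCol (l + 1) = ∑ i ∈ Finset.range b, π.phi i (l + 1) := by
  classical
  obtain ⟨G, hG⟩ := aux_exists_G π
  let S : ℕ → Finset ℕ := fun i => Finset.Ico (max (G i (l + 1)) (G (i + 1) l)) (G i l)
  have hS : ∀ i j, j ∈ S i ↔ π.entry i j = l + 1 ∧ π.entry (i + 1) j < l + 1 := by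
    intro i j
    have := Set.ext_iff.1 (aux_set hG i l) j
    exact this.symm
  have hun : {j | ∃ i, π.entry i j = l + 1} = ↑((Finset.range b).biUnion S) := by
    ext j
    simp only [Set.mem_setOf_eq, Finset.coe_biUnion, Set.mem_iUnion, Finset.mem_coe,
      Finset.mem_range, hS, exists_prop]
    constructor
    · rintro ⟨i, hi⟩
      by_contra! hcon
      have : ∀ k, π.entry (i + k) j = l + 1 := by
        intro k
        induction k with
        | zero => exact hi
        | succ k ih =>
          have hlt : i + k < b := by
            by_contra hb
            have := h (i + k) j (by omega)
            omega
          have h1 := hcon (i + k) hlt ih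
          have h2 := π.col_decr (i + k) j
          rw [← add_assoc]
          omega
      have h1 := this b
      have h2 := h (i + b) j (by omega)
      omega
    · rintro ⟨i, _, hi, _⟩
      exact ⟨i, hi⟩
  have hdisj : ∀ i k j, i < k → j ∈ S i → j ∈ S k → False := by
    intro i k j hik h1 h2
    rw [hS] at h1 h2
    have : π.entry k j ≤ π.entry (i + 1) j := aux_col π j hik
    omega
  unfold PlanePartition.cCol
  rw [hun, Set.ncard_coe_finset, Finset.card_biUnion]
  · refine Finset.sum_congr rfl fun i _ => ?_
    rw [aux_phi hG, Nat.card_Ico]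
  · intro i _ k _ hik
    refine Finset.disjoint_left.2 ?_
    intro j h1 h2
    rcases lt_or_gt_of_ne hik with hlt | hlt
    · exact hdisj i k j hlt h1 h2
    · exact hdisj k i j hlt h2 h1

/-- the weight of a plane partition -/
noncomputable def auxWt (c : ℕ) (q : ℕ → ℝ) (π : PlanePartition) : ℝ :=
  ∏ ℓ ∈ Finset.range c, q ℓ ^ π.cCol (ℓ + 1)

theorem aux_wt {π : PlanePartition} {b : ℕ} (c : ℕ) (q : ℕ → ℝ) (h : π.rowsLE b) :
    auxWt c q π = ∏ p : Fin b × Fin c, q p.2 ^ π.phi p.1 (p.2 + 1) := by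
  unfold auxWt
  rw [Fintype.prod_prod_type_right, Finset.prod_range]
  refine Finset.prod_congr rfl fun l _ => ?_
  rw [aux_cCol h, Finset.sum_range, ← Finset.prod_pow_eq_pow_sum]

noncomputable def auxPhiFin (b c : ℕ) (π : PPinf b c) : Fin b × Fin c → ℕ :=
  fun p => π.1.phi p.1 (p.2 + 1)

theorem auxPhi_bij (b c : ℕ) : Function.Bijective (auxPhiFin b c) := by
  constructor
  · rintro ⟨π, h⟩ ⟨π', h'⟩ heq
    refine Subtype.ext (aux_inj h h' fun i hi l hl => ?_)
    exact congrFun heq (⟨i, hi⟩, ⟨l, hl⟩)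
  · intro w
    obtain ⟨π, h, hw⟩ := aux_surj b c (matExt w)
    refine ⟨⟨π, h⟩, ?_⟩
    funext ⟨i, l⟩
    have := hw i i.2 l l.2
    simpa [auxPhiFin, matExt] using this

theorem aux_hasSum_PP (b c : ℕ) (q : ℕ → ℝ)
    (hq : ∀ i < c, q i ∈ Set.Ico (0 : ℝ) 1) :
    HasSum (fun π : PPinf b c => auxWt c q π.1) (∏ i ∈ Finset.range c, ((1 - q i)⁻¹) ^ b) := by
  have h1 := aux_hasSum (ι := Fin b × Fin c) (fun p k => q p.2 ^ k) (fun p => (1 - q p.2)⁻¹)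
    (fun p k => pow_nonneg (hq _ p.2.2).1 _)
    (fun p => hasSum_geometric_of_lt_one (hq _ p.2.2).1 (hq _ p.2.2).2)
  have h2 : ∏ p : Fin b × Fin c, (1 - q p.2)⁻¹ = ∏ i ∈ Finset.range c, ((1 - q i)⁻¹) ^ b := by
    rw [Fintype.prod_prod_type_right, Finset.prod_range]
    simp
  rw [h2, ← (Equiv.ofBijective _ (auxPhi_bij b c)).hasSum_iff] at h1
  convert h1 using 1
  funext π
  rw [aux_wt c q π.2.1]
  rfl

/-- the shape of a plane partition -/
noncomputable def auxShape (π : PlanePartition) : YoungDiagram where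
  cells := π.finite_support.toFinset
  isLowerSet := by
    rintro ⟨i, j⟩ ⟨i', j'⟩ hle hp
    simp only [Set.Finite.coe_toFinset, Set.mem_setOf_eq] at hp ⊢
    have h1 : π.entry i j' ≥ π.entry i j := aux_row π i hle.2
    have h2 : π.entry i' j' ≥ π.entry i j' := aux_col π j' hle.1
    omega

theorem aux_mem_shape (π : PlanePartition) (i j : ℕ) :
    (i, j) ∈ auxShape π ↔ 0 < π.entry i j := by
  rw [← YoungDiagram.mem_cells]
  simp [auxShape, Nat.pos_iff_ne_zero]

theorem aux_hasShape (π : PlanePartition) (μ : YoungDiagram) :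
    π.hasShape μ ↔ auxShape π = μ := by
  constructor
  · intro h
    ext ⟨i, j⟩
    rw [YoungDiagram.mem_cells, YoungDiagram.mem_cells, aux_mem_shape, h i j]
  · rintro rfl i j
    rw [aux_mem_shape]

theorem aux_shape_le {π : PlanePartition} {b : ℕ} :
    π.rowsLE b ↔ (auxShape π).colLen 0 ≤ b := by
  constructor
  · intro h
    by_contra! hcon
    have h1 := YoungDiagram.mem_iff_lt_colLen.2 hcon
    rw [aux_mem_shape] at h1
    have := h b 0 le_rfl
    omega
  · intro h i j hi
    by_contra hne
    have h1 := (aux_mem_shape π i j).2 (by omega)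
    have h2 := YoungDiagram.mem_iff_lt_colLen.1 h1
    have h3 := (auxShape π).colLen_anti 0 j (Nat.zero_le _)
    omega

theorem aux_finite (μ : YoungDiagram) (c : ℕ) :
    {π : PlanePartition | π.hasShape μ ∧ π.entriesLE c}.Finite := by
  rw [← Set.finite_coe_iff]
  refine Finite.of_injective
    (β := μ.cells → Fin (c + 1))
    (fun π p => ⟨π.1.entry p.1.1 p.1.2, Nat.lt_succ_of_le (π.2.2 _ _)⟩) ?_
  rintro ⟨π, h, hc⟩ ⟨π', h', hc'⟩ heq
  have hent : π.entry = π'.entry := by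
    funext i j
    by_cases hm : (i, j) ∈ μ
    · have := congrFun heq ⟨(i, j), (YoungDiagram.mem_cells _).2 hm⟩
      simpa using this
    · have h1 := (h i j).not.2 hm
      have h2 := (h' i j).not.2 hm
      omega
  cases π
  cases π'
  simpa using hent

theorem aux_groth (μ : YoungDiagram) (c : ℕ) (q : ℕ → ℝ) :
    grothG μ c q = ∑' π : {π : PlanePartition | π.hasShape μ ∧ π.entriesLE c},
      auxWt c q π.1 := by
  have := (aux_finite μ c).to_subtype
  rw [tsum_eq_finsum (Set.toFinite _)]
  unfold grothG
  exact (finsum_subtype_eq_finsum_cond (f := fun π => auxWt c q π) _).symm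

theorem aux_main (b c : ℕ) (q : ℕ → ℝ)
    (hq : ∀ i < c, q i ∈ Set.Ico (0 : ℝ) 1) :
    HasSum (fun μ : {μ : YoungDiagram // μ.colLen 0 ≤ b} => grothG μ.1 c q)
      (∏ i ∈ Finset.range c, ((1 - q i)⁻¹) ^ b) := by
  let g : PPinf b c → {μ : YoungDiagram // μ.colLen 0 ≤ b} :=
    fun π => ⟨auxShape π.1, aux_shape_le.1 π.2.1⟩
  have h := (aux_hasSum_PP b c q hq).tsum_fiberwise g
  refine h.congr_fun ?_
  intro μ
  rw [aux_groth]
  let e : (g ⁻¹' {μ}) ≃ {π : PlanePartition | π.hasShape μ.1 ∧ π.entriesLE c} :=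
    { toFun := fun π => ⟨π.1.1, (aux_hasShape _ _).2 (congrArg Subtype.val π.2), π.1.2.2⟩
      invFun := fun π => ⟨⟨π.1, aux_shape_le.2 (by
          rw [(aux_hasShape _ _).1 π.2.1]; exact μ.2), π.2.2⟩,
        Subtype.ext ((aux_hasShape _ _).1 π.2.1)⟩
      left_inv := fun π => rfl
      right_inv := fun π => rfl }
  exact (e.tsum_eq (fun π => auxWt c q π.1)).symm

/-- for `q_1,…,q_c ∈ [0,1)` the family `(g_λ(q_1,…,q_c))` over partitions `λ`
with at most `b` parts is summable, with sum `∏_{i=1}^{c} (1 − q_i)^{−b}`. -/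
theorem sum_grothG_lengthLE (b c : ℕ) (hb : 0 < b) (hc : 0 < c) (q : ℕ → ℝ)
    (hq : ∀ i < c, q i ∈ Set.Ico (0 : ℝ) 1) :
    Summable (fun μ : {μ : YoungDiagram // μ.colLen 0 ≤ b} => grothG μ.1 c q) ∧
    ∑' μ : {μ : YoungDiagram // μ.colLen 0 ≤ b}, grothG μ.1 c q
      = ∏ i ∈ Finset.range c, ((1 - q i)⁻¹) ^ b := by
  exact ⟨(aux_main b c q hq).summable, (aux_main b c q hq).tsum_eq⟩
end
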